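/- arXiv:2404.02426 — 5 statements merged into one kernel-verified Lean document; each statement's English description precedes it below -/
import Mathlib

section
/- Let n ∈ ℕ and let D be a nonempty closed subset of EuclideanSpace ℝ (Fin n). Let φ : ℝ → ℝ be continuous, monotone increasing, everywhere positive, and satisfy φ(u) → 0 as u → −∞. Let m ≥ 1 and, for j = 1,…,m, let w_j > 0, λ_j > 0, γ_j > 0, C_j ∈ ℝ and ẑ_j ∈ EuclideanSpace ℝ (Fin n). Then the cash flow density f(z, θ) = θ · Σ_{j=1}^m w_j · φ(C_j − (λ_j/2)·‖z − ẑ_j‖²) · exp(−γ_j·θ) attains its maximum on D × (0, ∞): there exists (z*, θ*) ∈ D × (0, ∞) such that f(z, θ) ≤ f(z*, θ*) for all (z, θ) ∈ D × (0, ∞). -/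
theorem stmt_2 (n : ℕ) (D : Set (EuclideanSpace ℝ (Fin n)))
    (hD : D.Nonempty) (hDclosed : IsClosed D)
    (φ : ℝ → ℝ) (hφc : Continuous φ) (hφmono : Monotone φ)
    (hφpos : ∀ u, 0 < φ u) (hφlim : Filter.Tendsto φ Filter.atBot (nhds 0))
    (m : ℕ) (hm : 1 ≤ m)
    (w lam γ C : Fin m → ℝ) (hw : ∀ j, 0 < w j) (hlam : ∀ j, 0 < lam j)
    (hγ : ∀ j, 0 < γ j) (zhat : Fin m → EuclideanSpace ℝ (Fin n))
    (f : EuclideanSpace ℝ (Fin n) → ℝ → ℝ)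
    (hf : ∀ z θ, f z θ =
      θ * ∑ j, w j * φ (C j - lam j / 2 * ‖z - zhat j‖ ^ 2) * Real.exp (-γ j * θ)) :
    ∃ zstar ∈ D, ∃ θstar ∈ Set.Ioi (0 : ℝ),
      ∀ z ∈ D, ∀ θ ∈ Set.Ioi (0 : ℝ), f z θ ≤ f zstar θstar := by
  classical
  have hg : ∀ j, Filter.Tendsto (fun z : EuclideanSpace ℝ (Fin n) =>
      φ (C j - lam j / 2 * ‖z - zhat j‖ ^ 2))
      (Filter.cocompact (EuclideanSpace ℝ (Fin n))) (nhds 0) := by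
    intro j
    apply hφlim.comp
    have h1 : Filter.Tendsto (fun z : EuclideanSpace ℝ (Fin n) => ‖z - zhat j‖)
        (Filter.cocompact (EuclideanSpace ℝ (Fin n))) Filter.atTop := by
      have h0 := tendsto_norm_cocompact_atTop (E := EuclideanSpace ℝ (Fin n))
      refine Filter.tendsto_atTop_mono (fun z => ?_)
        (Filter.tendsto_atTop_add_const_right _ (-‖zhat j‖) h0)
      have := norm_sub_norm_le z (zhat j)
      linarith
    have h2 := (Filter.tendsto_pow_atTop (two_ne_zero)).comp h1
    have h3 := h2.const_mul_atTop (half_pos (hlam j))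
    have h4 := Filter.tendsto_atBot_add_const_left _ (C j)
      (Filter.tendsto_neg_atTop_atBot.comp h3)
    refine h4.congr (fun z => ?_)
    simp [sub_eq_add_neg]
  have hh : ∀ j, Filter.Tendsto (fun θ : ℝ => |θ| * Real.exp (-γ j * |θ|))
      (Filter.cocompact ℝ) (nhds 0) := by
    intro j
    have h1 := Real.tendsto_pow_mul_exp_neg_atTop_nhds_zero 1
    have h0 := (tendsto_norm_cocompact_atTop (E := ℝ)).const_mul_atTop (hγ j)
    have h2 := (h1.comp h0).const_mul ((γ j)⁻¹)
    rw [mul_zero] at h2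
    refine h2.congr (fun θ => ?_)
    have := (hγ j).ne'
    simp only [Function.comp, Real.norm_eq_abs, pow_one, neg_mul]
    field_simp
  have hgb : ∀ j (z : EuclideanSpace ℝ (Fin n)),
      φ (C j - lam j / 2 * ‖z - zhat j‖ ^ 2) ≤ φ (C j) := by
    intro j z
    apply hφmono
    have := hlam j
    have : 0 ≤ lam j / 2 * ‖z - zhat j‖ ^ 2 := by positivity
    linarith
  have hhb : ∀ j (θ : ℝ), |θ| * Real.exp (-γ j * |θ|) ≤ (γ j)⁻¹ := by
    intro j θ
    have hp := hγ j
    have h1 := Real.add_one_le_exp (γ j * |θ|)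
    rw [neg_mul, Real.exp_neg, ← div_eq_mul_inv, div_le_iff₀ (Real.exp_pos _),
      ← div_eq_inv_mul, le_div_iff₀ hp]
    linarith
  have hterm : ∀ j, Filter.Tendsto (fun p : EuclideanSpace ℝ (Fin n) × ℝ =>
      φ (C j - lam j / 2 * ‖p.1 - zhat j‖ ^ 2) * (|p.2| * Real.exp (-γ j * |p.2|)))
      (Filter.cocompact _) (nhds 0) := by
    intro j
    rw [← Filter.coprod_cocompact, Filter.coprod]
    have hnn : ∀ p : EuclideanSpace ℝ (Fin n) × ℝ, 0 ≤
      φ (C j - lam j / 2 * ‖p.1 - zhat j‖ ^ 2) * (|p.2| * Real.exp (-γ j * |p.2|)) :=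
      fun p => mul_nonneg (hφpos _).le (by positivity)
    refine Filter.Tendsto.sup ?_ ?_
    · have := ((hg j).comp (Filter.tendsto_comap (f := (Prod.fst :
        EuclideanSpace ℝ (Fin n) × ℝ → _)))).mul_const ((γ j)⁻¹)
      rw [zero_mul] at this
      exact squeeze_zero hnn
        (fun p => mul_le_mul_of_nonneg_left (hhb j p.2) (hφpos _).le) this
    · have := ((hh j).comp (Filter.tendsto_comap (f := (Prod.snd :
        EuclideanSpace ℝ (Fin n) × ℝ → _)))).const_mul (φ (C j))
      rw [mul_zero] at this
      exact squeeze_zero hnn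
        (fun p => mul_le_mul_of_nonneg_right (hgb j p.1) (by positivity)) this
  have hF : Filter.Tendsto (fun p : EuclideanSpace ℝ (Fin n) × ℝ => f p.1 |p.2|)
      (Filter.cocompact _) (nhds 0) := by
    have := tendsto_finsetSum Finset.univ (fun j _ => (hterm j).const_mul (w j))
    simp only [mul_zero, Finset.sum_const_zero] at this
    refine this.congr (fun p => ?_)
    rw [hf, Finset.mul_sum]
    exact Finset.sum_congr rfl (fun j _ => by ring)
  have hcont : Continuous (fun p : EuclideanSpace ℝ (Fin n) × ℝ => f p.1 |p.2|) := by
    simp only [hf]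
    fun_prop
  obtain ⟨z0, hz0⟩ := hD
  have hpos : 0 < f z0 1 := by
    rw [hf, one_mul]
    have : Nonempty (Fin m) := ⟨⟨0, hm⟩⟩
    exact Finset.sum_pos (fun j _ => mul_pos (mul_pos (hw j) (hφpos _)) (Real.exp_pos _))
      Finset.univ_nonempty
  obtain ⟨⟨zs, t⟩, hs, hmax⟩ := hcont.continuousOn.exists_isMaxOn'
    (s := D ×ˢ (Set.univ : Set ℝ)) (x₀ := (z0, 1)) (hDclosed.prod isClosed_univ)
    ⟨hz0, trivial⟩ (by
      refine Filter.Eventually.filter_mono inf_le_left ?_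
      refine (hF.eventually (gt_mem_nhds hpos)).mono (fun p hp => ?_)
      simpa using hp.le)
  have hmax' : ∀ z ∈ D, ∀ θ : ℝ, f z |θ| ≤ f zs |t| :=
    fun z hz θ => hmax (show (z, θ) ∈ D ×ˢ (Set.univ : Set ℝ) from ⟨hz, trivial⟩)
  refine ⟨zs, hs.1, |t|, ?_, fun z hz θ hθ => ?_⟩
  · rw [Set.mem_Ioi, abs_pos]
    rintro rfl
    have h1 := hmax' z0 hz0 1
    rw [abs_one, abs_zero, hf zs 0, zero_mul] at h1
    linarith
  · have := hmax' z hz θ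
    rwa [abs_of_pos (Set.mem_Ioi.mp hθ)] at this
end

section
/- Let E be a real Hilbert space (e.g. EuclideanSpace ℝ (Fin n)), let D ⊆ E be nonempty, closed and convex, let φ : ℝ → ℝ be strictly increasing and everywhere positive, and let K > 0, λ > 0, γ > 0, C ∈ ℝ, ẑ ∈ E. Let z* be the unique point of D nearest to ẑ. Then for f(z, θ) = θ · K · φ(C − (λ/2)·‖z − ẑ‖²) · exp(−γ·θ), the pair (z*, 1/γ) is the unique maximizer of f on D × (0, ∞): f(z, θ) ≤ f(z*, 1/γ) for all (z, θ) ∈ D × (0, ∞), with equality only if z = z* and θ = 1/γ. -/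
theorem stmt_3 {E : Type*} [NormedAddCommGroup E] [InnerProductSpace ℝ E]
    (D : Set E) (hD : D.Nonempty) (hDclosed : IsClosed D) (hDconvex : Convex ℝ D)
    (φ : ℝ → ℝ) (hφ : StrictMono φ) (hφpos : ∀ u, 0 < φ u)
    (K lam γ : ℝ) (hK : 0 < K) (hlam : 0 < lam) (hγ : 0 < γ) (C : ℝ) (zhat : E)
    (zstar : E) (hzstar : zstar ∈ D)
    (hnear : ∀ w ∈ D, ‖zstar - zhat‖ ≤ ‖w - zhat‖)
    (huniq : ∀ w ∈ D, ‖w - zhat‖ = ‖zstar - zhat‖ → w = zstar)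
    (f : E → ℝ → ℝ)
    (hf : ∀ z θ, f z θ =
      θ * K * φ (C - lam / 2 * ‖z - zhat‖ ^ 2) * Real.exp (-γ * θ)) :
    (∀ z ∈ D, ∀ θ ∈ Set.Ioi (0 : ℝ), f z θ ≤ f zstar (1 / γ)) ∧
    (∀ z ∈ D, ∀ θ ∈ Set.Ioi (0 : ℝ),
      f z θ = f zstar (1 / γ) → z = zstar ∧ θ = 1 / γ) := by
  have key : ∀ θ : ℝ, θ ≠ 1 / γ →
      θ * Real.exp (-γ * θ) < 1 / γ * Real.exp (-γ * (1 / γ)) := by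
    intro θ hne
    have h1 : γ * θ - 1 ≠ 0 := by
      intro h
      apply hne
      field_simp
      linarith
    have h2 := Real.add_one_lt_exp h1
    have h3 : γ * θ < Real.exp (γ * θ - 1) := by linarith
    have h4 := mul_lt_mul_of_pos_right h3 (Real.exp_pos (-γ * θ))
    rw [← Real.exp_add] at h4
    have e1 : γ * θ - 1 + -γ * θ = -γ * (1 / γ) := by
      field_simp
      ring
    rw [e1] at h4
    have h5 := mul_lt_mul_of_pos_left h4 (one_div_pos.mpr hγ)
    have e2 : 1 / γ * (γ * θ * Real.exp (-γ * θ)) = θ * Real.exp (-γ * θ) := by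
      field_simp
    rwa [e2] at h5
  have keyle : ∀ θ : ℝ, θ * Real.exp (-γ * θ) ≤ 1 / γ * Real.exp (-γ * (1 / γ)) := by
    intro θ
    by_cases h : θ = 1 / γ
    · rw [h]
    · exact (key θ h).le
  have hφle : ∀ z ∈ D, φ (C - lam / 2 * ‖z - zhat‖ ^ 2) ≤
      φ (C - lam / 2 * ‖zstar - zhat‖ ^ 2) := by
    intro z hz
    apply hφ.monotone
    have := hnear z hz
    gcongr
  have hf' : ∀ z θ, f z θ =
      K * (φ (C - lam / 2 * ‖z - zhat‖ ^ 2) * (θ * Real.exp (-γ * θ))) := by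
    intro z θ
    rw [hf]
    ring
  have main : ∀ z ∈ D, ∀ θ ∈ Set.Ioi (0 : ℝ), f z θ ≤ f zstar (1 / γ) := by
    intro z hz θ hθ
    have hθ' : 0 < θ := hθ
    rw [hf', hf']
    exact mul_le_mul_of_nonneg_left
      (mul_le_mul (hφle z hz) (keyle θ) (by positivity) (hφpos _).le) hK.le
  refine ⟨main, ?_⟩
  intro z hz θ hθ heq
  have hθ' : 0 < θ := hθ
  rw [hf', hf'] at heq
  have heq2 := mul_left_cancel₀ hK.ne' heq
  have hg : 0 < θ * Real.exp (-γ * θ) := by positivity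
  constructor
  · apply huniq z hz
    by_contra hne
    have hlt := lt_of_le_of_ne (hnear z hz) (Ne.symm hne)
    have hφlt : φ (C - lam / 2 * ‖z - zhat‖ ^ 2) <
        φ (C - lam / 2 * ‖zstar - zhat‖ ^ 2) := by
      apply hφ
      gcongr
    exact (mul_lt_mul hφlt (keyle θ) hg (hφpos _).le).ne heq2
  · by_contra hne
    exact (mul_lt_mul' (hφle z hz) (key θ hne) hg.le (hφpos _)).ne heq2
end

section
/- Let m ≥ 1, M > 0 and ν > 0, and for j = 1,…,m let w_j > 0 and λ_j ∈ (0, M]. Then there exists ε > 0 such that for all μ_1,…,μ_m ∈ ℝ with |μ_j| < ε for every j, the function f(t) = Σ_{j=1}^m w_j · exp(λ_j·(μ_j·t − ν·t²)) has at most one maximum point on [0, ∞): the set of points t ∈ [0, ∞) at which f attains a local maximum relative to [0, ∞) has at most one element. -/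
theorem stmt_8 (m : ℕ) (hm : 1 ≤ m) (M ν : ℝ) (hM : 0 < M) (hν : 0 < ν)
    (w lam : Fin m → ℝ) (hw : ∀ j, 0 < w j)
    (hlam : ∀ j, lam j ∈ Set.Ioc 0 M) :
    ∃ ε > 0, ∀ μ : Fin m → ℝ, (∀ j, |μ j| < ε) →
      {t : ℝ | 0 ≤ t ∧
        IsLocalMaxOn (fun t : ℝ => ∑ j, w j * Real.exp (lam j * (μ j * t - ν * t ^ 2)))
          (Set.Ici (0 : ℝ)) t}.Subsingleton := by
  have hpos : 0 < ν / (4 * M) := by positivity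
  have hne : (Finset.univ : Finset (Fin m)).Nonempty := ⟨⟨0, hm⟩, Finset.mem_univ _⟩
  refine ⟨Real.sqrt (ν / (4 * M)), Real.sqrt_pos.2 hpos, ?_⟩
  have hε2 : Real.sqrt (ν / (4 * M)) ^ 2 * (4 * M) = ν := by
    rw [Real.sq_sqrt hpos.le]; field_simp
  have hε : 0 < Real.sqrt (ν / (4 * M)) := Real.sqrt_pos.2 hpos
  generalize Real.sqrt (ν / (4 * M)) = ε at hε2 hε
  intro μ hμ
  set f : ℝ → ℝ := fun t : ℝ => ∑ j, w j * Real.exp (lam j * (μ j * t - ν * t ^ 2)) with hf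
  set f1 : ℝ → ℝ := fun t : ℝ => ∑ j, w j * (Real.exp (lam j * (μ j * t - ν * t ^ 2)) *
    (lam j * (μ j - 2 * ν * t))) with hf1
  set f2 : ℝ → ℝ := fun t : ℝ => ∑ j, w j * (Real.exp (lam j * (μ j * t - ν * t ^ 2)) *
    (lam j * (lam j * (μ j - 2 * ν * t) ^ 2 - 2 * ν))) with hf2
  have hin : ∀ j t, HasDerivAt (fun t : ℝ => Real.exp (lam j * (μ j * t - ν * t ^ 2)))
      (Real.exp (lam j * (μ j * t - ν * t ^ 2)) * (lam j * (μ j - 2 * ν * t))) t := by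
    intro j t
    have h := ((((hasDerivAt_id t).const_mul (μ j)).sub
      ((hasDerivAt_pow 2 t).const_mul ν)).const_mul (lam j)).exp
    refine HasDerivAt.congr_deriv (f := fun t : ℝ => Real.exp (lam j * (μ j * t - ν * t ^ 2))) h ?_
    simp only [Pi.sub_apply, id]
    push_cast
    ring
  have hd1 : ∀ t, HasDerivAt f (f1 t) t := fun t =>
    HasDerivAt.fun_sum fun j _ => (hin j t).const_mul (w j)
  have hd2 : ∀ t, HasDerivAt f1 (f2 t) t := fun t =>
    HasDerivAt.fun_sum fun j _ => by
      have h0 : HasDerivAt (fun t : ℝ => lam j * (μ j - 2 * ν * t)) (lam j * (- (2 * ν))) t := by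
        simpa using (((hasDerivAt_id t).const_mul (2 * ν)).const_sub (μ j)).const_mul (lam j)
      have h := ((hin j t).mul h0).const_mul (w j)
      refine HasDerivAt.congr_deriv h ?_
      ring
  have hcont : Continuous f := continuous_iff_continuousAt.2 fun t => (hd1 t).continuousAt
  have e1 : deriv f = f1 := funext fun t => (hd1 t).deriv
  have e2 : deriv f1 = f2 := funext fun t => (hd2 t).deriv
  have hδ : 0 < ε / (2 * ν) := by positivity
  have hδ2 : ε / (2 * ν) * (2 * ν) = ε := by field_simp
  generalize ε / (2 * ν) = δ at hδ hδ2
  have hanti : StrictAntiOn f (Set.Ici δ) := by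
    apply strictAntiOn_of_deriv_neg (convex_Ici δ) hcont.continuousOn
    intro t ht
    rw [interior_Ici, Set.mem_Ioi] at ht
    rw [e1]
    apply Finset.sum_neg (fun j _ => ?_) hne
    have h1 : μ j - 2 * ν * t < 0 := by
      have := (abs_lt.1 (hμ j)).2
      nlinarith
    exact mul_neg_of_pos_of_neg (hw j) (mul_neg_of_pos_of_neg (Real.exp_pos _)
      (mul_neg_of_pos_of_neg (hlam j).1 h1))
  have hconc : StrictConcaveOn ℝ (Set.Icc 0 δ) f := by
    apply strictConcaveOn_of_deriv2_neg (convex_Icc 0 δ) hcont.continuousOn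
    intro t ht
    rw [interior_Icc] at ht
    simp only [Function.iterate_succ, Function.iterate_zero, Function.comp, id]
    rw [e1, e2]
    apply Finset.sum_neg (fun j _ => ?_) hne
    have hs : (μ j - 2 * ν * t) ^ 2 ≤ (2 * ε) ^ 2 := by
      have := abs_lt.1 (hμ j)
      have h3 : 2 * ν * t < ε := by nlinarith [ht.2]
      have h4 : 0 < 2 * ν * t := by have := ht.1; positivity
      apply sq_le_sq'  <;> linarith
    have h1 : lam j * (μ j - 2 * ν * t) ^ 2 - 2 * ν < 0 := by
      have : lam j * (μ j - 2 * ν * t) ^ 2 ≤ M * (2 * ε) ^ 2 :=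
        mul_le_mul (hlam j).2 hs (sq_nonneg _) hM.le
      nlinarith
    exact mul_neg_of_pos_of_neg (hw j) (mul_neg_of_pos_of_neg (Real.exp_pos _)
      (mul_neg_of_pos_of_neg (hlam j).1 h1))
  have hle : ∀ t, IsLocalMaxOn f (Set.Ici 0) t → t ≤ δ := by
    intro t ht
    by_contra! hlt
    have h0 : ∀ᶠ x in nhds t, x ∈ Set.Ici (0:ℝ) → f x ≤ f t := eventually_nhdsWithin_iff.1 ht
    have h1 : ∀ᶠ x in nhdsWithin t (Set.Iio t), δ < x :=
      (lt_mem_nhds hlt).filter_mono nhdsWithin_le_nhds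
    obtain ⟨x, ⟨hx1, hx2⟩, hx3⟩ :=
      (((h0.filter_mono nhdsWithin_le_nhds).and h1).and self_mem_nhdsWithin).exists
    have := hanti hx2.le hlt.le hx3
    have := hx1 (hδ.le.trans hx2.le)
    linarith
  have hmax : ∀ t, 0 ≤ t → IsLocalMaxOn f (Set.Ici 0) t → IsMaxOn f (Set.Icc 0 δ) t :=
    fun t h0 ht => IsMaxOn.of_isLocalMaxOn_of_concaveOn ⟨h0, hle t ht⟩
      (ht.on_subset Set.Icc_subset_Ici_self) hconc.concaveOn
  rintro a ⟨ha0, ha⟩ b ⟨hb0, hb⟩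
  exact hconc.eq_of_isMaxOn (hmax a ha0 ha) (hmax b hb0 hb) ⟨ha0, hle a ha⟩ ⟨hb0, hle b hb⟩
end

section
/- In the plane EuclideanSpace ℝ (Fin 2), fix δ > 0, m ∈ ℕ, points x_0, …, x_m, opening times t_0, …, t_m ∈ ℝ and visibility broadening speeds k_0, …, k_m > 0. For i = 0,…,m and t ∈ ℝ, define q_{i,t}(x) = exp(−δ·‖x − x_i‖) if ‖x − x_i‖ ≤ k_i·(t − t_i) and 0 otherwise, and let q̃_{0,t}(x) = (max_{0≤i≤m} q_{i,t}(x)) · q_{0,t}(x) / (Σ_{i=0}^m q_{i,t}(x)), interpreted as 0 when the denominator vanishes. Define the limiting proportion q̃_0(x) = (max_{0≤i≤m} exp(−δ·‖x − x_i‖)) · exp(−δ·‖x − x_0‖) / (Σ_{i=0}^m exp(−δ·‖x − x_i‖)). Then for every x, q̃_{0,t}(x) → q̃_0(x) as t → +∞, and for every constant u > 0, ∫_{ℝ²} q̃_{0,t}(x)·u dx → ∫_{ℝ²} q̃_0(x)·u dx as t → +∞. -/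
open MeasureTheory

lemma aux_int (δ : ℝ) (hδ : 0 < δ) :
    Integrable (fun y : EuclideanSpace ℝ (Fin 2) => Real.exp (-δ * ‖y‖)) volume := by
  have h := (integrable_one_add_norm (E := EuclideanSpace ℝ (Fin 2)) (μ := volume) (r := 3)
    (by simp; norm_num)).const_mul (Real.exp δ * 6 / δ ^ 3)
  refine h.mono' (by fun_prop) (Filter.Eventually.of_forall fun y => ?_)
  have hs : 0 < 1 + ‖y‖ := by positivity
  rw [Real.norm_of_nonneg (Real.exp_pos _).le]
  have h1 := Real.pow_div_factorial_le_exp (x := δ * (1 + ‖y‖)) (by positivity) 3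
  have h2 : (1 + ‖y‖) ^ (-3 : ℝ) = ((1 + ‖y‖) ^ 3)⁻¹ := by
    rw [Real.rpow_neg hs.le]; norm_cast
  have h3 : Real.exp (-δ * ‖y‖) = Real.exp δ * (Real.exp (δ * (1 + ‖y‖)))⁻¹ := by
    rw [← Real.exp_neg, ← Real.exp_add]; congr 1; ring
  have h4 : Real.exp δ * 6 / δ ^ 3 * ((1 + ‖y‖) ^ 3)⁻¹
      = Real.exp δ * ((δ * (1 + ‖y‖)) ^ 3 / (Nat.factorial 3 : ℝ))⁻¹ := by
    simp [Nat.factorial]; field_simp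
  rw [h2, h3, h4]
  gcongr

theorem stmt_15 (δ : ℝ) (hδ : 0 < δ) (m : ℕ)
    (x : Fin (m + 1) → EuclideanSpace ℝ (Fin 2)) (t₀ : Fin (m + 1) → ℝ)
    (k : Fin (m + 1) → ℝ) (hk : ∀ i, 0 < k i)
    (q : Fin (m + 1) → ℝ → EuclideanSpace ℝ (Fin 2) → ℝ)
    (hq : ∀ i t y, q i t y =
      if ‖y - x i‖ ≤ k i * (t - t₀ i) then Real.exp (-δ * ‖y - x i‖) else 0)
    (qt : ℝ → EuclideanSpace ℝ (Fin 2) → ℝ)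
    (hqt : ∀ t y, qt t y =
      (Finset.univ.sup' Finset.univ_nonempty (fun i => q i t y)) * q 0 t y /
        (∑ i, q i t y))
    (qlim : EuclideanSpace ℝ (Fin 2) → ℝ)
    (hqlim : ∀ y, qlim y =
      (Finset.univ.sup' Finset.univ_nonempty (fun i => Real.exp (-δ * ‖y - x i‖))) *
        Real.exp (-δ * ‖y - x 0‖) / (∑ i, Real.exp (-δ * ‖y - x i‖))) :
    (∀ y, Filter.Tendsto (fun t => qt t y) Filter.atTop (nhds (qlim y))) ∧
    (∀ u : ℝ, 0 < u →
      Filter.Tendsto (fun t => ∫ y, qt t y * u ∂volume) Filter.atTop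
        (nhds (∫ y, qlim y * u ∂volume))) := by
  have hpt : ∀ y, Filter.Tendsto (fun t => qt t y) Filter.atTop (nhds (qlim y)) := by
    intro y
    have hev : ∀ᶠ t in Filter.atTop, ∀ i, q i t y = Real.exp (-δ * ‖y - x i‖) := by
      rw [Filter.eventually_all]
      intro i
      filter_upwards [Filter.eventually_ge_atTop (‖y - x i‖ / k i + t₀ i)] with t ht
      rw [hq, if_pos]
      have h1 : ‖y - x i‖ / k i ≤ t - t₀ i := by linarith
      rw [div_le_iff₀ (hk i)] at h1
      linarith
    refine tendsto_const_nhds.congr' ?_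
    filter_upwards [hev] with t ht
    simp only [hqt, hqlim, ht]
  refine ⟨hpt, fun u hu => ?_⟩
  have hq0 : ∀ i t y, 0 ≤ q i t y := by
    intro i t y; rw [hq]; split_ifs <;> positivity
  have hqm : ∀ i t, Measurable (q i t) := by
    intro i t
    have : q i t = fun y => if ‖y - x i‖ ≤ k i * (t - t₀ i) then
        Real.exp (-δ * ‖y - x i‖) else 0 := funext (hq i t)
    rw [this]
    exact Measurable.ite (measurableSet_le (by fun_prop) (by fun_prop)) (by fun_prop) (by fun_prop)
  have hqtm : ∀ t, Measurable (qt t) := by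
    intro t
    have : qt t = fun y => (Finset.univ.sup' Finset.univ_nonempty (fun i => q i t)) y * q 0 t y /
        (∑ i, q i t y) := by
      funext y; rw [hqt, Finset.sup'_apply]
    rw [this]
    have h1 : Measurable (Finset.univ.sup' Finset.univ_nonempty (fun i => q i t)) :=
      Finset.measurable_sup' _ (fun i _ => hqm i t)
    exact (h1.mul (hqm 0 t)).div (Finset.measurable_fun_sum _ (fun i _ => hqm i t))
  refine tendsto_integral_filter_of_dominated_convergence
    (fun y => Real.exp (-δ * ‖y - x 0‖) * u) ?_ ?_ ?_ ?_
  · exact Filter.Eventually.of_forall fun t => ((hqtm t).mul_const u).aestronglyMeasurable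
  · refine Filter.Eventually.of_forall fun t => Filter.Eventually.of_forall fun y => ?_
    have hS : 0 ≤ ∑ i, q i t y := Finset.sum_nonneg fun i _ => hq0 i t y
    have hM0 : 0 ≤ Finset.univ.sup' Finset.univ_nonempty (fun i => q i t y) :=
      (hq0 0 t y).trans (Finset.le_sup' (fun i => q i t y) (Finset.mem_univ 0))
    have hM : Finset.univ.sup' Finset.univ_nonempty (fun i => q i t y) ≤ ∑ i, q i t y :=
      Finset.sup'_le _ _ fun i _ =>
        Finset.single_le_sum (f := fun i => q i t y) (fun j _ => hq0 j t y) (Finset.mem_univ i)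
    have hle : q 0 t y ≤ Real.exp (-δ * ‖y - x 0‖) := by
      rw [hq]; split_ifs
      · exact le_rfl
      · positivity
    have hn : 0 ≤ qt t y := by
      rw [hqt]; exact div_nonneg (mul_nonneg hM0 (hq0 0 t y)) hS
    rw [Real.norm_of_nonneg (mul_nonneg hn hu.le)]
    refine mul_le_mul_of_nonneg_right (le_trans ?_ hle) hu.le
    rw [hqt]
    refine div_le_of_le_mul₀ hS (hq0 0 t y) ?_
    rw [mul_comm]
    exact mul_le_mul_of_nonneg_left hM (hq0 0 t y)
  · exact ((aux_int δ hδ).comp_sub_right (x 0)).mul_const u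
  · exact Filter.Eventually.of_forall fun y => (hpt y).mul_const u
end

section
/- In the plane EuclideanSpace ℝ (Fin 2), fix δ > 0, u > 0, m ∈ ℕ, points x_0, …, x_m, opening times t_0, …, t_m ∈ ℝ and visibility broadening speeds k_0, …, k_m > 0. For i = 0,…,m and t ∈ ℝ, define q_{i,t}(x) = exp(−δ·‖x − x_i‖) if ‖x − x_i‖ ≤ k_i·(t − t_i) and 0 otherwise, and let q̃_{0,t}(x) = (max_{0≤i≤m} q_{i,t}(x)) · q_{0,t}(x) / (Σ_{i=0}^m q_{i,t}(x)), interpreted as 0 when the denominator vanishes. Define the limiting proportion q̃_0(x) = (max_{0≤i≤m} exp(−δ·‖x − x_i‖)) · exp(−δ·‖x − x_0‖) / (Σ_{i=0}^m exp(−δ·‖x − x_i‖)) and the competing equivalent foot traffic density u′ = u · (δ²/(2π)) · ∫_{ℝ²} q̃_0(x) dx. Then ∫_{ℝ²} q_{0,t}(x)·u′ dx − ∫_{ℝ²} q̃_{0,t}(x)·u dx → 0 as t → +∞. -/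
open MeasureTheory

theorem aux_integral (δ : ℝ) (hδ : 0 < δ) (a : EuclideanSpace ℝ (Fin 2)) :
    ∫ y : EuclideanSpace ℝ (Fin 2), Real.exp (-δ * ‖y - a‖) = 2 * Real.pi / δ ^ 2 := by
  rw [integral_sub_right_eq_self (fun y : EuclideanSpace ℝ (Fin 2) => Real.exp (-δ * ‖y‖)) a]
  rw [integral_fun_norm_addHaar volume (fun r : ℝ => Real.exp (-δ * r))]
  have h := Real.integral_rpow_mul_exp_neg_mul_Ioi (a := 2) (r := δ) two_pos hδ
  have h2 : ∫ y in Set.Ioi (0 : ℝ), y ^ (Module.finrank ℝ (EuclideanSpace ℝ (Fin 2)) - 1) •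
      Real.exp (-δ * y) = (1 / δ) ^ (2 : ℝ) * Real.Gamma 2 := by
    rw [← h]
    refine setIntegral_congr_fun measurableSet_Ioi (fun t ht => ?_)
    have : (2 : ℝ) - 1 = 1 := by norm_num
    simp [this]
  rw [h2]
  have hv : (volume : Measure (EuclideanSpace ℝ (Fin 2))).real (Metric.ball 0 1) = Real.pi := by
    simp [Measure.real, Real.pi_nonneg]
  rw [hv]
  simp [Real.Gamma_two]
  field_simp

theorem stmt_16 (δ u : ℝ) (hδ : 0 < δ) (hu : 0 < u) (m : ℕ)
    (x : Fin (m + 1) → EuclideanSpace ℝ (Fin 2)) (t₀ : Fin (m + 1) → ℝ)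
    (k : Fin (m + 1) → ℝ) (hk : ∀ i, 0 < k i)
    (q : Fin (m + 1) → ℝ → EuclideanSpace ℝ (Fin 2) → ℝ)
    (hq : ∀ i t y, q i t y =
      if ‖y - x i‖ ≤ k i * (t - t₀ i) then Real.exp (-δ * ‖y - x i‖) else 0)
    (qt : ℝ → EuclideanSpace ℝ (Fin 2) → ℝ)
    (hqt : ∀ t y, qt t y =
      (Finset.univ.sup' Finset.univ_nonempty (fun i => q i t y)) * q 0 t y /
        (∑ i, q i t y))
    (qlim : EuclideanSpace ℝ (Fin 2) → ℝ)
    (hqlim : ∀ y, qlim y =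
      (Finset.univ.sup' Finset.univ_nonempty (fun i => Real.exp (-δ * ‖y - x i‖))) *
        Real.exp (-δ * ‖y - x 0‖) / (∑ i, Real.exp (-δ * ‖y - x i‖)))
    (u' : ℝ) (hu' : u' = u * (δ ^ 2 / (2 * Real.pi)) * ∫ y, qlim y ∂volume) :
    Filter.Tendsto
      (fun t => (∫ y, q 0 t y * u' ∂volume) - ∫ y, qt t y * u ∂volume)
      Filter.atTop (nhds 0) := by
  have hI := aux_integral δ hδ (x 0)
  have hint : Integrable (fun y : EuclideanSpace ℝ (Fin 2) => Real.exp (-δ * ‖y - x 0‖)) :=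
    .of_integral_ne_zero (by rw [hI]; positivity)
  have hq0 : ∀ i t y, 0 ≤ q i t y := by
    intro i t y; rw [hq]; split_ifs <;> positivity
  have hqle : ∀ i t y, q i t y ≤ Real.exp (-δ * ‖y - x i‖) := by
    intro i t y; rw [hq]; split_ifs
    · exact le_rfl
    · positivity
  have hqm : ∀ i t, Measurable (q i t) := by
    intro i t
    have : q i t = fun y => if ‖y - x i‖ ≤ k i * (t - t₀ i) then
      Real.exp (-δ * ‖y - x i‖) else 0 := funext (hq i t)
    rw [this]
    refine Measurable.ite (measurableSet_le (by fun_prop) (by fun_prop)) (by fun_prop) (by fun_prop)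
  have hqtm : ∀ t, Measurable (qt t) := by
    intro t
    have h1 : qt t = fun y => (Finset.univ.sup' Finset.univ_nonempty (fun i => q i t)) y * q 0 t y /
        (∑ i, q i t y) := by
      funext y; rw [hqt, Finset.sup'_apply]
    rw [h1]
    refine Measurable.div (Measurable.mul ?_ (hqm 0 t)) ?_
    · exact Finset.measurable_sup' Finset.univ_nonempty (fun i _ => hqm i t)
    · exact Finset.measurable_sum _ (fun i _ => hqm i t)
  have hev : ∀ y, ∀ᶠ t in Filter.atTop, ∀ i, q i t y = Real.exp (-δ * ‖y - x i‖) := by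
    intro y
    rw [Filter.eventually_all]
    intro i
    filter_upwards [Filter.eventually_ge_atTop (‖y - x i‖ / k i + t₀ i)] with t ht
    rw [hq, if_pos]
    have : ‖y - x i‖ / k i ≤ t - t₀ i := by linarith
    rw [div_le_iff₀ (hk i)] at this
    linarith
  have hqt0 : ∀ t y, 0 ≤ qt t y := by
    intro t y
    rw [hqt]
    refine div_nonneg (mul_nonneg ?_ (hq0 0 t y)) (Finset.sum_nonneg fun i _ => hq0 i t y)
    exact (hq0 0 t y).trans (Finset.le_sup' (fun i => q i t y) (Finset.mem_univ 0))
  have hqtle : ∀ t y, qt t y ≤ Real.exp (-δ * ‖y - x 0‖) := by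
    intro t y
    refine le_trans ?_ (hqle 0 t y)
    rw [hqt]
    refine div_le_of_le_mul₀ (Finset.sum_nonneg fun i _ => hq0 i t y) (hq0 0 t y) ?_
    rw [mul_comm]
    refine mul_le_mul_of_nonneg_left ?_ (hq0 0 t y)
    refine Finset.sup'_le _ _ fun i _ => ?_
    exact Finset.single_le_sum (f := fun i => q i t y) (fun j _ => hq0 j t y) (Finset.mem_univ i)
  have T1 : Filter.Tendsto (fun t => ∫ y, q 0 t y) Filter.atTop
      (nhds (∫ y, Real.exp (-δ * ‖y - x 0‖))) := by
    refine tendsto_integral_filter_of_dominated_convergence _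
      (.of_forall fun t => (hqm 0 t).aestronglyMeasurable)
      (.of_forall fun t => .of_forall fun y => ?_) hint (.of_forall fun y => ?_)
    · rw [Real.norm_of_nonneg (hq0 0 t y)]; exact hqle 0 t y
    · refine tendsto_const_nhds.congr' ?_
      filter_upwards [hev y] with t ht using (ht 0).symm
  have T2 : Filter.Tendsto (fun t => ∫ y, qt t y) Filter.atTop (nhds (∫ y, qlim y)) := by
    refine tendsto_integral_filter_of_dominated_convergence _
      (.of_forall fun t => (hqtm t).aestronglyMeasurable)
      (.of_forall fun t => .of_forall fun y => ?_) hint (.of_forall fun y => ?_)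
    · rw [Real.norm_of_nonneg (hqt0 t y)]; exact hqtle t y
    · refine tendsto_const_nhds.congr' ?_
      filter_upwards [hev y] with t ht
      rw [hqt, hqlim]
      simp only [ht]
  simp only [integral_mul_const]
  have := (T1.mul_const u').sub (T2.mul_const u)
  rw [hI, hu'] at this
  rw [hu']
  convert! this using 2
  field_simp
  ring
end
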